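/- arXiv:1703.06828 — 3 statements merged into one kernel-verified Lean document; each statement's English description precedes it below -/
import Mathlib

section
/- Let k be a field, let r ≥ 1 be an integer, let σ_1 ≥ σ_2 ≥ … ≥ σ_r be real numbers, and let A ≥ 0 be a real number. Let (c_{i,j})_{1 ≤ j ≤ i ≤ r} be scalars in k and let φ : k[x_1, …, x_r] → k[x_1, …, x_r] be the k-algebra endomorphism determined by φ(x_i) = c_{i,1} x_1 + c_{i,2} x_2 + … + c_{i,i} x_i for each i (a lower-triangular linear substitution of the variables). Then for every integer m ≥ 1, φ maps the subspace B_m into B_m, where B_m ⊆ k[x_1, …, x_r] is the k-linear span of the monomials x^α of total degree m satisfying σ_1 α_1 + … + σ_r α_r > A. -/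
open MvPolynomial

/-- The exponents of total degree `m` and `σ`-weight at least `a`. -/
def weightAtLeast {ι : Type*} [Fintype ι] (σ : ι → ℝ) (m : ℕ) (a : ℝ) : Set (ι →₀ ℕ) :=
  {α | (∑ i, α i) = m ∧ a ≤ ∑ i, σ i * (α i : ℝ)}

section weightAtLeast

variable {ι k : Type*} [Fintype ι] [CommSemiring k] {σ : ι → ℝ}

theorem mul_mem_restrictSupport_weightAtLeast {m n : ℕ} {a b : ℝ} {p q : MvPolynomial ι k}
    (hp : p ∈ restrictSupport k (weightAtLeast σ m a))
    (hq : q ∈ restrictSupport k (weightAtLeast σ n b)) :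
    p * q ∈ restrictSupport k (weightAtLeast σ (m + n) (a + b)) := by
  have h := Submodule.mul_mem_mul hp hq
  rw [← restrictSupport_add] at h
  refine restrictSupport_mono k ?_ h
  rintro _ ⟨α, hα, β, hβ, rfl⟩
  refine ⟨?_, ?_⟩
  · simp [Finset.sum_add_distrib, hα.1, hβ.1]
  · simpa [mul_add, Finset.sum_add_distrib] using add_le_add hα.2 hβ.2

theorem one_mem_restrictSupport_weightAtLeast :
    (1 : MvPolynomial ι k) ∈ restrictSupport k (weightAtLeast σ 0 0) :=
  (monomial_mem_restrictSupport k).2 (Or.inl (by simp [weightAtLeast]))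

theorem pow_mem_restrictSupport_weightAtLeast {a : ℝ} {p : MvPolynomial ι k}
    (hp : p ∈ restrictSupport k (weightAtLeast σ 1 a)) (n : ℕ) :
    p ^ n ∈ restrictSupport k (weightAtLeast σ n (a * n)) := by
  induction n with
  | zero => simpa using one_mem_restrictSupport_weightAtLeast
  | succ n ih =>
    rw [pow_succ]
    simpa [mul_add] using mul_mem_restrictSupport_weightAtLeast ih hp

theorem X_mem_restrictSupport_weightAtLeast {a : ℝ} {i : ι} (h : a ≤ σ i) :
    (X i : MvPolynomial ι k) ∈ restrictSupport k (weightAtLeast σ 1 a) := by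
  classical
  exact (monomial_mem_restrictSupport k).2
    (Or.inl (by simpa [weightAtLeast, Finsupp.single_apply] using h))

theorem algHom_monomial_mem_restrictSupport_weightAtLeast
    (φ : MvPolynomial ι k →ₐ[k] MvPolynomial ι k)
    (hφ : ∀ i, φ (X i) ∈ restrictSupport k (weightAtLeast σ 1 (σ i))) (α : ι →₀ ℕ) :
    φ (monomial α 1) ∈
      restrictSupport k (weightAtLeast σ (∑ i, α i) (∑ i, σ i * (α i : ℝ))) := by
  classical
  induction α using Finsupp.induction_linear with
  | zero => simpa using one_mem_restrictSupport_weightAtLeast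
  | add α β hα hβ =>
    rw [← one_mul (1 : k), ← monomial_mul, map_mul]
    simpa [mul_add, Finset.sum_add_distrib] using mul_mem_restrictSupport_weightAtLeast hα hβ
  | single i n =>
    rw [← X_pow_eq_monomial, map_pow]
    simpa [Finsupp.single_apply] using pow_mem_restrictSupport_weightAtLeast (hφ i) n

end weightAtLeast

/-- A lower-triangular linear substitution of the variables maps each
monomial subspace `B_m` (spanned by monomials `x^α` of total degree `m` with
`σ · α > A`) into itself, provided `σ` is nonincreasing and `A ≥ 0`. -/
theorem stmt2 (k : Type*) [Field k] (r : ℕ) (hr : 1 ≤ r)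
    (σ : Fin r → ℝ) (hσ : ∀ i j : Fin r, i ≤ j → σ j ≤ σ i)
    (A : ℝ) (hA : 0 ≤ A)
    (c : Fin r → Fin r → k) (hc : ∀ i j : Fin r, i < j → c i j = 0)
    (φ : MvPolynomial (Fin r) k →ₐ[k] MvPolynomial (Fin r) k)
    (hφ : ∀ i : Fin r, φ (X i) = ∑ j, C (c i j) * X j)
    (B : ℕ → Submodule k (MvPolynomial (Fin r) k))
    (hBm : ∀ m : ℕ,
      B m = Submodule.span k
        ((fun α : Fin r →₀ ℕ => (monomial α (1 : k) : MvPolynomial (Fin r) k)) ''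
          {α : Fin r →₀ ℕ | (∑ i, α i) = m ∧ A < ∑ i, σ i * (α i : ℝ)})) :
    ∀ m : ℕ, 1 ≤ m → ∀ f ∈ B m, φ f ∈ B m := by
  intro m _ f hf
  have hX : ∀ i, φ (X i) ∈ restrictSupport k (weightAtLeast σ 1 (σ i)) := fun i => by
    rw [hφ]
    refine Submodule.sum_mem _ fun j _ => ?_
    rcases lt_or_ge i j with hij | hij
    · simp [hc i j hij]
    · rw [C_mul']
      exact Submodule.smul_mem _ _ (X_mem_restrictSupport_weightAtLeast (hσ j i hij))
  suffices B m ≤ (B m).comap φ.toLinearMap from this hf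
  conv_lhs => rw [hBm]
  rw [Submodule.span_le]
  rintro _ ⟨α, ⟨hdeg, hwt⟩, rfl⟩
  change φ (monomial α 1) ∈ B m
  rw [hBm, ← restrictSupport_eq_span]
  refine restrictSupport_mono k ?_ (algHom_monomial_mem_restrictSupport_weightAtLeast φ hX α)
  exact fun β hβ => ⟨hβ.1.trans hdeg, hwt.trans_le hβ.2⟩
end

section
/- Let r ≥ 2 be an integer, let σ_1 ≥ σ_2 ≥ … ≥ σ_r be real numbers with σ_1 > 0, let A ≥ 0 be a real number, and let w be a permutation of {1, …, r}. Consider the subset S of ℝ^{r-1} consisting of all points of the form (α_{w(1)}/m, α_{w(2)}/m, …, α_{w(r-1)}/m), where m ≥ 1 is an integer and α = (α_1, …, α_r) ∈ ℕ^r satisfies α_1 + … + α_r = m and σ_1 α_1 + … + σ_r α_r > A. Then the topological closure of S in ℝ^{r-1} equals the polytope { (ν_1, …, ν_{r-1}) ∈ ℝ^{r-1} : ν_i ≥ 0 for all i, Σ_{i=1}^{r-1} ν_i ≤ 1, and Σ_{i=1}^{r-1} σ_{w(i)} ν_i + σ_{w(r)} (1 − Σ_{i=1}^{r-1} ν_i)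 ≥ 0 }. -/
open Filter Topology

/-- Adding a sublinear multiple of a positive-weight coordinate to the rounding down of `k ^ 2 • b`
makes the weight tend to infinity. -/
lemma tendsto_weight_floor_add_atTop {ι : Type*} [Fintype ι] [DecidableEq ι] (τ b : ι → ℝ)
    (hb : ∀ i, 0 ≤ b i) (hτb : 0 ≤ ∑ i, τ i * b i) (j : ι) (hj : 0 < τ j) :
    Tendsto (fun k : ℕ ↦
      ∑ i, τ i * ((⌊b i * (k : ℝ) ^ 2⌋₊ + (if i = j then k else 0) : ℕ) : ℝ)) atTop atTop := by
  have hlin : Tendsto (fun k : ℕ ↦ -(∑ i, |τ i|) + τ j * (k : ℝ)) atTop atTop :=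
    tendsto_atTop_add_const_left _ _ (tendsto_natCast_atTop_atTop.const_mul_atTop hj)
  refine tendsto_atTop_mono (fun k ↦ ?_) hlin
  have hfloor : ∀ i, τ i * b i * (k : ℝ) ^ 2 - |τ i| ≤ τ i * (⌊b i * (k : ℝ) ^ 2⌋₊ : ℝ) := by
    intro i
    have h1 := Nat.floor_le (mul_nonneg (hb i) (sq_nonneg (k : ℝ)))
    have h2 := Nat.lt_floor_add_one (b i * (k : ℝ) ^ 2)
    have h3 : |b i * (k : ℝ) ^ 2 - (⌊b i * (k : ℝ) ^ 2⌋₊ : ℝ)| ≤ 1 := by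
      rw [abs_le]; constructor <;> linarith
    have h4 := le_abs_self (τ i * (b i * (k : ℝ) ^ 2 - (⌊b i * (k : ℝ) ^ 2⌋₊ : ℝ)))
    rw [abs_mul] at h4
    have h5 := mul_le_mul_of_nonneg_left h3 (abs_nonneg (τ i))
    linarith
  have hsum := Finset.sum_le_sum fun i (_ : i ∈ Finset.univ) ↦ hfloor i
  rw [Finset.sum_sub_distrib, ← Finset.sum_mul] at hsum
  have hpos := mul_nonneg hτb (sq_nonneg (k : ℝ))
  simp only [Nat.cast_add, Nat.cast_ite, Nat.cast_zero, mul_add, mul_ite, mul_zero,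
    Finset.sum_add_distrib, Finset.sum_ite_eq', Finset.mem_univ, if_true]
  linarith

lemma tendsto_floor_add_div_sq {b : ℝ} (hb : 0 ≤ b) (p : Prop) [Decidable p] :
    Tendsto (fun k : ℕ ↦ ((⌊b * (k : ℝ) ^ 2⌋₊ + (if p then k else 0) : ℕ) : ℝ) / (k : ℝ) ^ 2)
      atTop (𝓝 b) := by
  have hsq : Tendsto (fun k : ℕ ↦ (k : ℝ) ^ 2) atTop atTop :=
    (tendsto_pow_atTop two_ne_zero).comp tendsto_natCast_atTop_atTop
  have hfloor := (tendsto_nat_floor_mul_div_atTop hb).comp hsq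
  have hextra : Tendsto (fun k : ℕ ↦ ((if p then k else 0 : ℕ) : ℝ) / (k : ℝ) ^ 2)
      atTop (𝓝 0) := by
    by_cases hp : p
    · refine (tendsto_inv_atTop_nhds_zero_nat (𝕜 := ℝ)).congr fun k ↦ ?_
      rcases eq_or_ne (k : ℝ) 0 with hk | hk
      · simp [hk]
      · simp only [hp, if_true]
        field_simp
    · simp [hp]
  have h := hfloor.add hextra
  rw [add_zero] at h
  refine h.congr fun k ↦ ?_
  simp only [Function.comp_apply, Nat.cast_add, add_div]

/-- A point of the standard simplex of nonnegative weight is a limit of normalized exponent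
vectors of weight larger than `A`. -/
lemma exists_seq_normalized_exponents {ι : Type*} [Fintype ι] (τ b : ι → ℝ)
    (hb : ∀ i, 0 ≤ b i) (hb1 : ∑ i, b i = 1) (hτb : 0 ≤ ∑ i, τ i * b i)
    (hτ : ∃ j, 0 < τ j) (A : ℝ) :
    ∃ α : ℕ → ι → ℕ, (∀ᶠ k in atTop, 1 ≤ ∑ i, α k i ∧ A < ∑ i, τ i * (α k i : ℝ)) ∧
      ∀ i, Tendsto (fun k ↦ (α k i : ℝ) / ((∑ i, α k i : ℕ) : ℝ)) atTop (𝓝 (b i)) := by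
  classical
  obtain ⟨j, hj⟩ := hτ
  let α : ℕ → ι → ℕ := fun k i ↦ ⌊b i * (k : ℝ) ^ 2⌋₊ + (if i = j then k else 0)
  have hα : ∀ i, Tendsto (fun k ↦ (α k i : ℝ) / (k : ℝ) ^ 2) atTop (𝓝 (b i)) :=
    fun i ↦ tendsto_floor_add_div_sq (hb i) (i = j)
  have hdeg : Tendsto (fun k ↦ ((∑ i, α k i : ℕ) : ℝ) / (k : ℝ) ^ 2) atTop (𝓝 1) := by
    rw [← hb1]
    refine (tendsto_finsetSum Finset.univ fun i _ ↦ hα i).congr fun k ↦ ?_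
    rw [Nat.cast_sum, Finset.sum_div]
  refine ⟨α, ?_, fun i ↦ ?_⟩
  · filter_upwards [(tendsto_weight_floor_add_atTop τ b hb hτb j hj).eventually_gt_atTop A,
      eventually_ge_atTop 1] with k hA hk
    refine ⟨?_, hA⟩
    calc 1 ≤ α k j := by simp only [α, if_true]; omega
      _ ≤ ∑ i, α k i := Finset.single_le_sum (fun i _ ↦ Nat.zero_le (α k i)) (Finset.mem_univ j)
  · have h := (hα i).div hdeg one_ne_zero
    rw [div_one] at h
    refine h.congr' ?_
    filter_upwards [eventually_ge_atTop 1] with k hk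
    have hk0 : (k : ℝ) ^ 2 ≠ 0 := by positivity
    exact div_div_div_cancel_right₀ hk0 _ _

lemma closure_normalized_exponents_eq (n : ℕ) (τ : Fin (n + 1) → ℝ) (hτ : ∃ j, 0 < τ j)
    (A : ℝ) (hA : 0 ≤ A) :
    closure {ν : Fin n → ℝ | ∃ α : Fin (n + 1) → ℕ, 1 ≤ ∑ i, α i ∧
        A < ∑ i, τ i * (α i : ℝ) ∧
        ∀ i : Fin n, ν i = (α i.castSucc : ℝ) / ((∑ i, α i : ℕ) : ℝ)} =
      {ν : Fin n → ℝ | (∀ i, 0 ≤ ν i) ∧ ∑ i, ν i ≤ 1 ∧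
        0 ≤ (∑ i : Fin n, τ i.castSucc * ν i) + τ (Fin.last n) * (1 - ∑ i, ν i)} := by
  apply Set.Subset.antisymm
  · refine closure_minimal ?_ ?_
    · rintro ν ⟨α, hm, hαA, hν⟩
      obtain rfl : ν = fun i ↦ (α i.castSucc : ℝ) / ((∑ i, α i : ℕ) : ℝ) := funext hν
      have hm0 : (0 : ℝ) < ((∑ i, α i : ℕ) : ℝ) := by exact_mod_cast hm
      have hlast : 1 - ∑ i : Fin n, (α i.castSucc : ℝ) / ((∑ i, α i : ℕ) : ℝ) =
          (α (Fin.last n) : ℝ) / ((∑ i, α i : ℕ) : ℝ) := by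
        rw [← Finset.sum_div, eq_div_iff hm0.ne', sub_mul, div_mul_cancel₀ _ hm0.ne', one_mul]
        push_cast [Fin.sum_univ_castSucc]
        ring
      refine ⟨fun i ↦ by positivity, ?_, ?_⟩
      · rw [← sub_nonneg, hlast]
        positivity
      · rw [hlast]
        simp only [← mul_div_assoc]
        rw [← Finset.sum_div, ← add_div, ← Fin.sum_univ_castSucc fun i ↦ τ i * (α i : ℝ)]
        exact div_nonneg (hA.trans hαA.le) hm0.le
    · simp only [Set.ofPred_and, Set.ofPred_forall]
      refine (isClosed_iInter fun i ↦ isClosed_le (by fun_prop) (by fun_prop)).inter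
        ((isClosed_le (by fun_prop) (by fun_prop)).inter
          (isClosed_le (by fun_prop) (by fun_prop)))
  · rintro ν ⟨hν0, hν1, hτν⟩
    obtain ⟨α, hαA, hα⟩ := exists_seq_normalized_exponents τ
      (Fin.snoc (α := fun _ ↦ ℝ) ν (1 - ∑ i, ν i))
      (fun i ↦ by refine Fin.lastCases ?_ (fun i ↦ ?_) i <;> simp [hν0, hν1])
      (by simp [Fin.sum_univ_castSucc])
      (by simpa [Fin.sum_univ_castSucc] using hτν) hτ A
    refine mem_closure_of_tendsto
      (f := fun k (i : Fin n) ↦ (α k i.castSucc : ℝ) / ((∑ i, α k i : ℕ) : ℝ))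
      (tendsto_pi_nhds.2 fun i ↦ ?_) (hαA.mono fun k hk ↦ ⟨α k, hk.1, hk.2, fun _ ↦ rfl⟩)
    simpa using hα i.castSucc

/-- The closure of the set of normalized exponent vectors
`(α_{w(1)}/m, …, α_{w(r-1)}/m)` of monomials of total degree `m` with `σ · α > A`
equals the polytope of points `ν` of the standard simplex `Δ_{r-1}` satisfying
`Σ σ_{w(i)} ν_i + σ_{w(r)} (1 - Σ ν_i) ≥ 0`. -/
theorem stmt3 (r : ℕ) (hr : 2 ≤ r) (σ : Fin r → ℝ)
    (hσ : ∀ i j : Fin r, i ≤ j → σ j ≤ σ i)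
    (hσ1 : 0 < σ ⟨0, by omega⟩)
    (A : ℝ) (hA : 0 ≤ A)
    (w : Equiv.Perm (Fin r)) :
    closure {ν : Fin (r - 1) → ℝ |
        ∃ (m : ℕ) (α : Fin r → ℕ), 1 ≤ m ∧ (∑ i, α i) = m ∧
          A < (∑ i, σ i * (α i : ℝ)) ∧
          ∀ i : Fin (r - 1),
            ν i = (α (w (Fin.castLE (by omega) i)) : ℝ) / (m : ℝ)} =
      {ν : Fin (r - 1) → ℝ |
        (∀ i, 0 ≤ ν i) ∧ (∑ i, ν i) ≤ 1 ∧
          0 ≤ (∑ i : Fin (r - 1), σ (w (Fin.castLE (by omega) i)) * ν i) +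
            σ (w ⟨r - 1, by omega⟩) * (1 - ∑ i, ν i)} := by
  obtain ⟨n, rfl⟩ : ∃ n, r = n + 1 := ⟨r - 1, by omega⟩
  refine Eq.trans (congrArg closure (Set.ext fun ν ↦ ?_))
    (closure_normalized_exponents_eq n (σ ∘ w) ⟨w.symm ⟨0, by omega⟩, by simpa using hσ1⟩ A hA)
  constructor
  · rintro ⟨m, α, hm, rfl, hαA, hν⟩
    have hsum : ∑ i, (α ∘ w) i = ∑ i, α i := Equiv.sum_comp w α
    refine ⟨α ∘ w, hsum ▸ hm, ?_, fun i ↦ ?_⟩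
    · exact hαA.trans_eq (Equiv.sum_comp w fun i ↦ σ i * (α i : ℝ)).symm
    · rw [hsum]
      exact hν i
  · rintro ⟨α, hm, hαA, hν⟩
    refine ⟨∑ i, α i, α ∘ w.symm, hm, Equiv.sum_comp w.symm α, ?_, fun i ↦ ?_⟩
    · refine hαA.trans_eq ?_
      rw [← Equiv.sum_comp w fun i ↦ σ i * ((α ∘ w.symm) i : ℝ)]
      simp
    · simp only [Function.comp_apply, Equiv.symm_apply_apply]
      exact hν i
end

section
/- Let ℓ ≥ 1 and r_1, …, r_ℓ ≥ 1 be integers with r = r_1 + … + r_ℓ, let μ_1, …, μ_ℓ be real numbers, and let t ∈ ℝ. Let s = (s_1, …, s_r) ∈ ℝ^r be the vector in which the value μ_i appears exactly r_i times, in order (s_1 = … = s_{r_1} = μ_1, s_{r_1+1} = … = s_{r_1+r_2} = μ_2, and so on). Then the following equality of Lebesgue integrals holds: ∫_{Δ_{ℓ-1}} max{ μ_1(1 − Σ_{i=2}^{ℓ} β_i) + Σ_{i=2}^{ℓ} μ_i β_i − t, 0 } · (1 − Σ_{i=2}^{ℓ} β_i)^{r_1 − 1} · Π_{i=2}^{ℓ}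 β_i^{r_i − 1} / ((r_1 − 1)! ⋯ (r_ℓ − 1)!) dβ = ∫_{Δ_{r-1}} max{ s_1(1 − Σ_{j=2}^{r} λ_j) + Σ_{j=2}^{r} s_j λ_j − t, 0 } dλ, where Δ_{ℓ-1} ⊆ ℝ^{ℓ-1} and Δ_{r-1} ⊆ ℝ^{r-1} are the full dimensional standard simplices and dβ, dλ are the standard Lebesgue measures. -/
open MeasureTheory

/-- Lebesgue measure on the nonnegative half-line. -/
noncomputable abbrev halfLine : Measure ℝ := volume.restrict (Set.Ici 0)

theorem lintegral_halfLine_shear {α : Type*} [MeasurableSpace α] (ρ : Measure α) [SFinite ρ]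
    {S : α → ℝ} (hS : Measurable S) {G : ℝ → α → ENNReal}
    (hG : Measurable (Function.uncurry G)) :
    ∫⁻ y, ∫⁻ a, G a y ∂halfLine ∂ρ = ∫⁻ u, ∫⁻ y in {y | S y ≤ u}, G (u - S y) y ∂ρ := by
  have hm : MeasurableSet {p : α × ℝ | S p.1 ≤ p.2} :=
    measurableSet_le (by fun_prop) (by fun_prop)
  have hGm : Measurable fun p : α × ℝ => G (p.2 - S p.1) p.1 :=
    hG.comp (by fun_prop : Measurable fun p : α × ℝ => (p.2 - S p.1, p.1))
  have h1 : ∀ y, ∫⁻ a, G a y ∂halfLine =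
      ∫⁻ u, {p : α × ℝ | S p.1 ≤ p.2}.indicator (fun p => G (p.2 - S p.1) p.1) (y, u) := by
    intro y
    rw [← lintegral_indicator measurableSet_Ici, ← lintegral_sub_right_eq_self _ (S y)]
    refine lintegral_congr fun u => ?_
    simp [Set.indicator_apply]
  simp_rw [h1]
  rw [lintegral_lintegral_swap
    (f := fun y u => {p : α × ℝ | S p.1 ≤ p.2}.indicator (fun p => G (p.2 - S p.1) p.1) (y, u))
    (hGm.indicator hm).aemeasurable]
  refine lintegral_congr fun u => ?_
  have hu : MeasurableSet {y | S y ≤ u} := hS measurableSet_Iic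
  rw [← lintegral_indicator hu]
  rfl

theorem lintegral_halfLine_Iic_pow (k : ℕ) (u : ℝ) :
    ∫⁻ b in {b | b ≤ u}, ENNReal.ofReal (b ^ k / k.factorial) ∂halfLine =
      (Set.Ici 0).indicator (fun u => ENNReal.ofReal (u ^ (k + 1) / (k + 1).factorial)) u := by
  have hs : ({b | b ≤ u} : Set ℝ) ∩ Set.Ici 0 = Set.Icc 0 u := by
    ext b; simp [and_comm]
  have hu : MeasurableSet {b : ℝ | b ≤ u} := measurableSet_Iic
  rw [Measure.restrict_restrict hu, hs]
  rcases lt_or_ge u 0 with hu | hu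
  · simp [hu]
  · rw [← ofReal_integral_eq_lintegral_ofReal, integral_Icc_eq_integral_Ioc,
      ← intervalIntegral.integral_of_le hu, intervalIntegral.integral_div, integral_pow]
    · simp only [Set.indicator_apply, Set.mem_Ici, hu, if_true, Nat.factorial_succ]
      congr 1
      push_cast
      field_simp
      simp
    · exact (by fun_prop : Continuous fun b : ℝ => b ^ k / k.factorial).continuousOn.integrableOn_Icc
    · filter_upwards [ae_restrict_mem measurableSet_Icc] with b hb
      have := hb.1
      positivity

theorem lintegral_pi_succ (n : ℕ) {G : (Fin (n + 1) → ℝ) → ENNReal} (hG : Measurable G) :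
    ∫⁻ x, G x ∂(Measure.pi fun _ => halfLine) =
      ∫⁻ y, ∫⁻ a, G (Fin.cons a y) ∂halfLine ∂(Measure.pi fun _ : Fin n => halfLine) := by
  have h := (measurePreserving_piFinSuccAbove (fun _ : Fin (n + 1) => halfLine) 0).symm
  rw [← h.lintegral_comp hG, lintegral_prod_symm]
  · simp [MeasurableEquiv.piFinSuccAbove_symm_apply, Fin.insertNthEquiv]
  · exact (hG.comp (MeasurableEquiv.measurable _)).aemeasurable

theorem measurable_fin_cons (n : ℕ) :
    Measurable fun p : ℝ × (Fin n → ℝ) => (Fin.cons p.1 p.2 : Fin (n + 1) → ℝ) := by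
  refine measurable_pi_iff.2 fun i => ?_
  refine Fin.cases ?_ (fun j => ?_) i
  · simpa using measurable_fst
  · simp only [Fin.cons_succ]; fun_prop

theorem lintegral_pi_halfLine_sum (k : ℕ) {F : ℝ → ENNReal} (hF : Measurable F) :
    ∫⁻ x : Fin (k + 1) → ℝ, F (∑ i, x i) ∂(Measure.pi fun _ => halfLine) =
      ∫⁻ u, ENNReal.ofReal (u ^ k / k.factorial) * F u ∂halfLine := by
  induction k generalizing F with
  | zero =>
    rw [lintegral_pi_succ _ (by fun_prop)]
    simp
  | succ k ih =>
    rw [lintegral_pi_succ _ (by fun_prop), lintegral_lintegral_swap]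
    swap
    · simp only [Fin.sum_cons]
      fun_prop
    simp only [Fin.sum_cons]
    have h1 : ∀ a : ℝ, ∫⁻ y : Fin (k + 1) → ℝ, F (a + ∑ i, y i) ∂(Measure.pi fun _ => halfLine) =
        ∫⁻ u, ENNReal.ofReal (u ^ k / k.factorial) * F (a + u) ∂halfLine :=
      fun a => ih (F := fun u => F (a + u)) (by fun_prop)
    simp_rw [h1]
    rw [lintegral_lintegral_swap (by fun_prop),
      lintegral_halfLine_shear halfLine (S := id) measurable_id
        (G := fun a u => ENNReal.ofReal (u ^ k / k.factorial) * F (a + u)) (by fun_prop)]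
    rw [← lintegral_indicator measurableSet_Ici]
    refine lintegral_congr fun u => ?_
    simp only [id, sub_add_cancel]
    rw [lintegral_mul_const _ (by fun_prop), lintegral_halfLine_Iic_pow]
    simp only [Set.indicator_apply]
    split_ifs <;> simp

theorem map_sum_pi_halfLine (k : ℕ) :
    (Measure.pi fun _ : Fin (k + 1) => halfLine).map (fun x => ∑ i, x i) =
      halfLine.withDensity fun u => ENNReal.ofReal (u ^ k / k.factorial) := by
  refine Measure.ext_of_lintegral _ fun F hF => ?_
  rw [lintegral_map hF (by fun_prop), lintegral_pi_halfLine_sum k hF,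
    lintegral_withDensity_eq_lintegral_mul _ (by fun_prop) hF]
  rfl

theorem lintegral_fin_prod_eq_prod {n : ℕ} (μ : Fin n → Measure ℝ) [∀ i, SigmaFinite (μ i)]
    {f : Fin n → ℝ → ENNReal} (hf : ∀ i, Measurable (f i)) :
    ∫⁻ x, ∏ i, f i (x i) ∂(Measure.pi μ) = ∏ i, ∫⁻ a, f i a ∂(μ i) := by
  induction n with
  | zero => simp
  | succ n ih =>
    have h := (measurePreserving_piFinSuccAbove μ 0).symm
    rw [← h.lintegral_comp (by fun_prop), Fin.prod_univ_succ, ← ih _ fun i => hf i.succ,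
      ← lintegral_prod_mul (hf 0).aemeasurable
        (Finset.measurable_prod _ fun i _ => (hf i.succ).comp (measurable_pi_apply i)).aemeasurable]
    simp [MeasurableEquiv.piFinSuccAbove_symm_apply, Fin.insertNthEquiv, Fin.prod_univ_succ]

theorem pi_withDensity {n : ℕ} (μ : Fin n → Measure ℝ) [∀ i, SigmaFinite (μ i)]
    {f : Fin n → ℝ → ENNReal} (hf : ∀ i, Measurable (f i))
    [∀ i, SigmaFinite ((μ i).withDensity (f i))] :
    Measure.pi (fun i => (μ i).withDensity (f i)) =
      (Measure.pi μ).withDensity fun x => ∏ i, f i (x i) := by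
  refine Measure.pi_eq fun s hs => ?_
  rw [withDensity_apply _ (.univ_pi hs), Measure.restrict_pi_pi, lintegral_fin_prod_eq_prod _ hf]
  exact Finset.prod_congr rfl fun i _ => (withDensity_apply _ (hs i)).symm

theorem map_sigmaUncurry_pi {ι : Type*} [Fintype ι] {κ : ι → Type*} [∀ i, Fintype (κ i)]
    (μ : Measure ℝ) [SigmaFinite μ] :
    (Measure.pi fun i => Measure.pi fun _ : κ i => μ).map
      (fun x (p : Sigma κ) => x p.1 p.2) = Measure.pi fun _ => μ := by
  refine (Measure.pi_eq fun s hs => ?_).symm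
  rw [Measure.map_apply (by fun_prop) (.univ_pi hs)]
  have : (fun (x : (i : ι) → κ i → ℝ) (p : Sigma κ) => x p.1 p.2) ⁻¹' Set.univ.pi s =
      Set.univ.pi fun i => Set.univ.pi fun j => s ⟨i, j⟩ := by
    ext x; simp [Sigma.forall]
  rw [this, Measure.pi_pi]
  simp_rw [Measure.pi_pi]
  rw [Fintype.prod_sigma]

/-- Summing the coordinates over blocks of sizes `k i + 1` pushes Lebesgue measure on the
orthant forward to a product of Gamma-type densities. -/
theorem lintegral_pi_halfLine_blocks {n r : ℕ} (k : Fin n → ℕ)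
    (e : (Σ i, Fin (k i + 1)) ≃ Fin r) {F : (Fin n → ℝ) → ENNReal} (hF : Measurable F) :
    ∫⁻ x, F (fun i => ∑ j, x (e ⟨i, j⟩)) ∂(Measure.pi fun _ : Fin r => halfLine) =
      ∫⁻ y, (∏ i, ENNReal.ofReal (y i ^ k i / (k i).factorial)) * F y
        ∂(Measure.pi fun _ => halfLine) := by
  have hd : ∀ i, SigmaFinite
      (halfLine.withDensity fun u => ENNReal.ofReal (u ^ k i / (k i).factorial)) :=
    fun i => SigmaFinite.withDensity_ofReal _
  have hd' : ∀ i, SigmaFinite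
      ((Measure.pi fun _ : Fin (k i + 1) => halfLine).map (fun x => ∑ i, x i)) := by
    intro i; rw [map_sum_pi_halfLine]; exact hd i
  have he := measurePreserving_piCongrLeft (fun _ : Fin r => halfLine) e
  rw [← he.lintegral_comp (by fun_prop), ← map_sigmaUncurry_pi,
    lintegral_map (by fun_prop) (by fun_prop)]
  simp only [MeasurableEquiv.coe_piCongrLeft, Equiv.piCongrLeft_apply_apply]
  rw [← lintegral_map (f := F)
    (g := fun (x : (i : Fin n) → Fin (k i + 1) → ℝ) i => ∑ j, x i j) hF (by fun_prop),
    Measure.pi_map_pi (f := fun i (x : Fin (k i + 1) → ℝ) => ∑ j, x j) (by fun_prop)]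
  simp_rw [map_sum_pi_halfLine]
  rw [pi_withDensity _ (by fun_prop),
    lintegral_withDensity_eq_lintegral_mul _ (by fun_prop) hF]
  rfl

/-- The full-dimensional standard simplex. -/
def cornerSimplex (n : ℕ) : Set (Fin n → ℝ) := {z | (∀ i, 0 ≤ z i) ∧ ∑ i, z i ≤ 1}

theorem measurableSet_cornerSimplex (n : ℕ) : MeasurableSet (cornerSimplex n) := by
  unfold cornerSimplex
  measurability

theorem lintegral_comp_smul_pi {n : ℕ} {u : ℝ} (hu : 0 < u) {H : (Fin n → ℝ) → ENNReal}
    (hH : Measurable H) :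
    ∫⁻ y, H y = ENNReal.ofReal (u ^ n) * ∫⁻ z, H (u • z) := by
  rw [← lintegral_map hH (measurable_const_smul u), Measure.map_addHaar_smul _ hu.ne',
    lintegral_smul_measure, smul_eq_mul, ← mul_assoc, ← ENNReal.ofReal_mul (by positivity),
    Module.finrank_fin_fun, abs_of_pos (by positivity), mul_inv_cancel₀ (by positivity)]
  simp

/-- Integration over the orthant in coordinates `(total, point of the simplex)`. -/
theorem lintegral_pi_halfLine_eq_simplex (n : ℕ) {G : (Fin (n + 1) → ℝ) → ENNReal}
    (hG : Measurable G) :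
    ∫⁻ x, G x ∂(Measure.pi fun _ => halfLine) =
      ∫⁻ u in Set.Ioi 0, ENNReal.ofReal (u ^ n) *
        ∫⁻ z in cornerSimplex n, G (Fin.cons (u * (1 - ∑ i, z i)) (u • z)) := by
  have hc : Measurable fun p : ℝ × (Fin n → ℝ) => G (Fin.cons p.1 p.2) :=
    hG.comp (measurable_fin_cons n)
  have hS : Measurable fun y : Fin n → ℝ => ∑ i, y i := by fun_prop
  rw [lintegral_pi_succ n hG, lintegral_halfLine_shear _ hS
      (G := fun a y => G (Fin.cons a y)) hc,
    ← lintegral_indicator measurableSet_Ioi]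
  refine lintegral_congr_ae ?_
  filter_upwards [Measure.ae_ne volume (0 : ℝ)] with u hu0
  have hm : MeasurableSet {y : Fin n → ℝ | ∑ i, y i ≤ u} := hS measurableSet_Iic
  rw [← Measure.restrict_pi_pi, Measure.restrict_restrict hm, ← volume_pi]
  have hmem : ∀ y : Fin n → ℝ, y ∈ {y : Fin n → ℝ | ∑ i, y i ≤ u} ∩
      (Set.univ.pi fun _ => Set.Ici 0) ↔ ∑ i, y i ≤ u ∧ ∀ i, 0 ≤ y i := by
    intro y; simp only [Set.mem_inter_iff, Set.mem_univ_pi, Set.mem_ofPred_eq, Set.mem_Ici]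
  have hm' : MeasurableSet ({y : Fin n → ℝ | ∑ i, y i ≤ u} ∩
      (Set.univ.pi fun _ => Set.Ici 0)) := hm.inter (.univ_pi fun _ => measurableSet_Ici)
  rcases lt_or_gt_of_ne hu0 with hu | hu
  · have : {y : Fin n → ℝ | ∑ i, y i ≤ u} ∩ (Set.univ.pi fun _ => Set.Ici 0) = ∅ := by
      refine Set.eq_empty_of_forall_notMem fun y hy => ?_
      have h := (hmem y).1 hy
      exact absurd (Finset.sum_nonneg fun i _ => h.2 i) (by linarith [h.1])
    rw [this]
    simp [hu.le]
  · rw [Set.indicator_of_mem (Set.mem_Ioi.2 hu), ← lintegral_indicator hm',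
      ← lintegral_indicator (measurableSet_cornerSimplex n), lintegral_comp_smul_pi hu]
    · congr 1
      refine lintegral_congr fun z => ?_
      have h1 : u • z ∈ {y : Fin n → ℝ | ∑ i, y i ≤ u} ∩ (Set.univ.pi fun _ => Set.Ici 0) ↔
          z ∈ cornerSimplex n := by
        rw [hmem, cornerSimplex, Set.mem_ofPred_eq, and_comm]
        simp [← Finset.mul_sum, hu]
      by_cases hz : z ∈ cornerSimplex n
      · rw [Set.indicator_of_mem hz, Set.indicator_of_mem (h1.2 hz)]
        simp [← Finset.mul_sum, mul_sub]
      · rw [Set.indicator_of_notMem hz, Set.indicator_of_notMem (mt h1.1 hz)]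
    · exact (hc.comp (by fun_prop : Measurable fun y : Fin n → ℝ => (u - ∑ i, y i, y))).indicator hm'

/-- The positive part of the weighted mean of `m` minus `t`, cut off at total mass `1`. -/
noncomputable def coneFunction {n : ℕ} (m : Fin n → ℝ) (t : ℝ) (x : Fin n → ℝ) : ENNReal :=
  {p : ℝ × ℝ | p.1 < 1}.indicator (fun p => ENNReal.ofReal (max (p.2 / p.1 - t) 0))
    (∑ i, x i, ∑ i, m i * x i)

theorem measurable_coneFunction {n : ℕ} (m : Fin n → ℝ) (t : ℝ) :
    Measurable (coneFunction m t) := by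
  refine Measurable.comp (Measurable.indicator (by fun_prop) ?_) (by fun_prop)
  exact measurableSet_lt measurable_fst measurable_const

/-- The weighted integrand over the simplex. -/
noncomputable def simplexIntegrand {n : ℕ} (k : Fin (n + 1) → ℕ) (m : Fin (n + 1) → ℝ) (t : ℝ)
    (z : Fin n → ℝ) : ℝ :=
  max (m 0 * (1 - ∑ i, z i) + (∑ i : Fin n, m i.succ * z i) - t) 0 *
    ((1 - ∑ i, z i) ^ k 0 * ∏ i : Fin n, z i ^ k i.succ) / ∏ i, ((k i).factorial : ℝ)

theorem simplexIntegrand_nonneg {n : ℕ} (k : Fin (n + 1) → ℕ) (m : Fin (n + 1) → ℝ) (t : ℝ)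
    {z : Fin n → ℝ} (hz : z ∈ cornerSimplex n) : 0 ≤ simplexIntegrand k m t z := by
  have h0 : 0 ≤ 1 - ∑ i, z i := sub_nonneg.2 hz.2
  have h1 : 0 ≤ ∏ i : Fin n, z i ^ k i.succ :=
    Finset.prod_nonneg fun i _ => pow_nonneg (hz.1 i) _
  unfold simplexIntegrand
  positivity

theorem prod_mul_coneFunction_cons {n : ℕ} (k : Fin (n + 1) → ℕ) (m : Fin (n + 1) → ℝ) (t : ℝ)
    {u : ℝ} (hu : 0 < u) {z : Fin n → ℝ} (hz : z ∈ cornerSimplex n) :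
    (∏ i, ENNReal.ofReal ((Fin.cons (u * (1 - ∑ i, z i)) (u • z) : Fin (n + 1) → ℝ) i ^ k i /
        (k i).factorial)) * coneFunction m t (Fin.cons (u * (1 - ∑ i, z i)) (u • z)) =
      (Set.Iio 1).indicator (fun u => ENNReal.ofReal (u ^ ∑ i, k i)) u *
        ENNReal.ofReal (simplexIntegrand k m t z) := by
  have h0 : 0 ≤ 1 - ∑ i, z i := sub_nonneg.2 hz.2
  have hnn : ∀ i, 0 ≤ (Fin.cons (u * (1 - ∑ i, z i)) (u • z) : Fin (n + 1) → ℝ) i := by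
    refine Fin.cases ?_ fun i => ?_
    · simpa using mul_nonneg hu.le h0
    · simpa using mul_nonneg hu.le (hz.1 i)
  have hsum : ∑ i, (Fin.cons (u * (1 - ∑ i, z i)) (u • z) : Fin (n + 1) → ℝ) i = u := by
    simp [Fin.sum_cons, ← Finset.mul_sum, mul_sub]
  have hmsum : ∑ i, m i * (Fin.cons (u * (1 - ∑ i, z i)) (u • z) : Fin (n + 1) → ℝ) i =
      u * (m 0 * (1 - ∑ i, z i) + ∑ i : Fin n, m i.succ * z i) := by
    simp only [Fin.sum_univ_succ, Fin.cons_zero, Fin.cons_succ, Pi.smul_apply, smul_eq_mul,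
      mul_add, Finset.mul_sum]
    congr 1
    · ring
    · exact Finset.sum_congr rfl fun i _ => by ring
  have hprod : ∏ i, ((Fin.cons (u * (1 - ∑ i, z i)) (u • z) : Fin (n + 1) → ℝ) i ^ k i /
      (k i).factorial) = u ^ (∑ i, k i) * (((1 - ∑ i, z i) ^ k 0 * ∏ i : Fin n, z i ^ k i.succ) /
        ∏ i, ((k i).factorial : ℝ)) := by
    rw [Finset.prod_div_distrib, ← mul_div_assoc, Fin.prod_univ_succ, Fin.sum_univ_succ]
    simp only [Fin.cons_zero, Fin.cons_succ, Pi.smul_apply, smul_eq_mul, mul_pow,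
      Finset.prod_mul_distrib, Finset.prod_pow_eq_pow_sum, pow_add]
    ring
  rw [← ENNReal.ofReal_prod_of_nonneg fun i _ => div_nonneg (pow_nonneg (hnn i) _) (by positivity),
    coneFunction, hsum, hmsum, hprod]
  by_cases h1 : u < 1
  · have hP : 0 ≤ ((1 - ∑ i, z i) ^ k 0 * ∏ i : Fin n, z i ^ k i.succ) /
        ∏ i, ((k i).factorial : ℝ) := by
      have := Finset.prod_nonneg fun i (_ : i ∈ Finset.univ) => pow_nonneg (hz.1 i) (k i.succ)
      positivity
    simp only [Set.indicator_apply, Set.mem_ofPred_eq, Set.mem_Iio, h1, if_true]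
    rw [← ENNReal.ofReal_mul (by positivity), ← ENNReal.ofReal_mul (by positivity),
      mul_div_cancel_left₀ _ hu.ne', simplexIntegrand]
    congr 1
    ring
  · simp [h1]

theorem lintegral_coneFunction_eq {n : ℕ} (k : Fin (n + 1) → ℕ) (m : Fin (n + 1) → ℝ) (t : ℝ) :
    ∫⁻ y, (∏ i, ENNReal.ofReal (y i ^ k i / (k i).factorial)) * coneFunction m t y
        ∂(Measure.pi fun _ => halfLine) =
      (∫⁻ u in Set.Ioo 0 1, ENNReal.ofReal (u ^ (n + ∑ i, k i))) *
        ∫⁻ z in cornerSimplex n, ENNReal.ofReal (simplexIntegrand k m t z) := by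
  have hm := measurable_coneFunction m t
  have hI : Measurable (simplexIntegrand k m t) := by
    unfold simplexIntegrand; fun_prop
  rw [lintegral_pi_halfLine_eq_simplex n (by fun_prop)]
  have h1 : ∀ u ∈ Set.Ioi (0 : ℝ), ENNReal.ofReal (u ^ n) * ∫⁻ z in cornerSimplex n,
      (∏ i, ENNReal.ofReal ((Fin.cons (u * (1 - ∑ i, z i)) (u • z) : Fin (n + 1) → ℝ) i ^ k i /
        (k i).factorial)) * coneFunction m t (Fin.cons (u * (1 - ∑ i, z i)) (u • z)) =
      (Set.Iio 1).indicator (fun u => ENNReal.ofReal (u ^ (n + ∑ i, k i))) u *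
        ∫⁻ z in cornerSimplex n, ENNReal.ofReal (simplexIntegrand k m t z) := by
    intro u hu
    rw [setLIntegral_congr_fun (measurableSet_cornerSimplex n)
      fun z hz => prod_mul_coneFunction_cons k m t hu hz,
      lintegral_const_mul _ (by fun_prop), ← mul_assoc]
    congr 1
    simp only [Set.indicator_apply]
    split_ifs
    · rw [← ENNReal.ofReal_mul (pow_nonneg (le_of_lt hu) _), ← pow_add]
    · simp
  rw [setLIntegral_congr_fun measurableSet_Ioi h1,
    lintegral_mul_const _ ((by fun_prop : Measurable fun u : ℝ =>
      ENNReal.ofReal (u ^ (n + ∑ i, k i))).indicator measurableSet_Iio),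
    lintegral_indicator measurableSet_Iio, Measure.restrict_restrict measurableSet_Iio,
    Set.inter_comm, Set.Ioi_inter_Iio]

theorem coneFunction_blocks {n r : ℕ} {k : Fin n → ℕ} (e : (Σ i, Fin (k i + 1)) ≃ Fin r)
    {m : Fin n → ℝ} {s : Fin r → ℝ} (hs : ∀ p, s (e p) = m p.1) (t : ℝ) (x : Fin r → ℝ) :
    coneFunction m t (fun i => ∑ j, x (e ⟨i, j⟩)) = coneFunction s t x := by
  unfold coneFunction
  rw [← e.sum_comp x, ← e.sum_comp fun j => s j * x j, Fintype.sum_sigma, Fintype.sum_sigma]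
  simp [hs, Finset.mul_sum]

theorem setIntegral_simplexIntegrand_blocks {n r : ℕ} {k : Fin (n + 1) → ℕ}
    (e : (Σ i, Fin (k i + 1)) ≃ Fin (r + 1)) {m : Fin (n + 1) → ℝ} {s : Fin (r + 1) → ℝ}
    (hs : ∀ p, s (e p) = m p.1) (t : ℝ) :
    ∫ z in cornerSimplex n, simplexIntegrand k m t z =
      ∫ z in cornerSimplex r, simplexIntegrand 0 s t z := by
  have hcard : n + ∑ i, k i = r := by
    have := Fintype.card_congr e
    simp [Finset.sum_add_distrib] at this
    omega
  have hint : ∀ (n : ℕ) (k : Fin (n + 1) → ℕ) (m : Fin (n + 1) → ℝ),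
      ∫ z in cornerSimplex n, simplexIntegrand k m t z =
        (∫⁻ z in cornerSimplex n, ENNReal.ofReal (simplexIntegrand k m t z)).toReal := by
    intro n k m
    refine integral_eq_lintegral_of_nonneg_ae ?_ ?_
    · filter_upwards [ae_restrict_mem (measurableSet_cornerSimplex n)] with z hz
      exact simplexIntegrand_nonneg k m t hz
    · exact (by unfold simplexIntegrand; fun_prop :
        Measurable (simplexIntegrand k m t)).aestronglyMeasurable
  have h := lintegral_pi_halfLine_blocks k e (measurable_coneFunction m t)
  simp_rw [coneFunction_blocks e hs] at h
  have h' := lintegral_coneFunction_eq (0 : Fin (r + 1) → ℕ) s t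
  simp only [Pi.zero_apply, pow_zero, Nat.factorial_zero, Nat.cast_one, div_one,
    ENNReal.ofReal_one, Finset.prod_const_one, one_mul, Finset.sum_const_zero, add_zero] at h'
  rw [h', lintegral_coneFunction_eq, hcard] at h
  have hpos : ∫⁻ u in Set.Ioo (0 : ℝ) 1, ENNReal.ofReal (u ^ r) ≠ 0 := by
    rw [← pos_iff_ne_zero, setLIntegral_pos_iff (by fun_prop)]
    have : Function.support (fun u : ℝ => ENNReal.ofReal (u ^ r)) ∩ Set.Ioo 0 1 = Set.Ioo 0 1 := by
      refine Set.inter_eq_right.2 fun u hu => ?_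
      simpa using pow_pos hu.1 r
    rw [this]
    simp
  have hfin : ∫⁻ u in Set.Ioo (0 : ℝ) 1, ENNReal.ofReal (u ^ r) ≠ ⊤ := by
    refine ne_top_of_le_ne_top ENNReal.one_ne_top ?_
    calc _ ≤ ∫⁻ u in Set.Ioo (0 : ℝ) 1, 1 := by
          refine setLIntegral_mono measurable_const fun u hu => ?_
          exact ENNReal.ofReal_le_one.2 (pow_le_one₀ hu.1.le hu.2.le)
      _ = 1 := by simp
  rw [hint, hint, (ENNReal.mul_right_inj hpos hfin).1 h]

theorem sum_filter_lt_eq_sum_castLE {n : ℕ} (f : Fin n → ℕ) (i : Fin n) :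
    ∑ j ∈ Finset.univ.filter (fun j : Fin n => j < i), f j =
      ∑ j : Fin i, f (Fin.castLE i.2.le j) := by
  symm
  refine Finset.sum_bij (fun j _ => Fin.castLE i.2.le j) ?_ ?_ ?_ ?_
  · intro j _
    exact Finset.mem_filter.2 ⟨Finset.mem_univ _, j.2⟩
  · intro a _ b _ h
    simpa [Fin.ext_iff] using h
  · intro b hb
    exact ⟨⟨b, by simpa using hb⟩, Finset.mem_univ _, rfl⟩
  · intro _ _; rfl

theorem sum_filter_le_eq_add {n : ℕ} (f : Fin n → ℕ) (i : Fin n) :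
    ∑ j ∈ Finset.univ.filter (fun j : Fin n => j ≤ i), f j =
      ∑ j ∈ Finset.univ.filter (fun j : Fin n => j < i), f j + f i := by
  have : Finset.univ.filter (fun j : Fin n => j ≤ i) =
      insert i (Finset.univ.filter (fun j : Fin n => j < i)) := by
    ext j; simp [le_iff_eq_or_lt]
  rw [this, Finset.sum_insert (by simp), add_comm]

/-- Wolfe's integral over the `(ℓ-1)`-simplex (weighted by the ranks
`r_i` of the Harder–Narasimhan quotients) equals Chen's integral over the
`(r-1)`-simplex for the expanded slope vector `s`. -/
theorem stmt5 (ℓ r : ℕ) (hℓ : 1 ≤ ℓ)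
    (rk : Fin ℓ → ℕ) (hrk : ∀ i, 1 ≤ rk i) (hsum : (∑ i, rk i) = r)
    (μ : Fin ℓ → ℝ) (t : ℝ)
    (s : Fin r → ℝ)
    (hs : ∀ (i : Fin ℓ) (j : Fin r),
      (∑ i' ∈ Finset.univ.filter (fun i' : Fin ℓ => i' < i), rk i') ≤ j.1 →
      j.1 < (∑ i' ∈ Finset.univ.filter (fun i' : Fin ℓ => i' ≤ i), rk i') →
      s j = μ i) :
    (∫ β in {β : Fin (ℓ - 1) → ℝ | (∀ i, 0 ≤ β i) ∧ (∑ i, β i) ≤ 1},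
        max (μ ⟨0, by omega⟩ * (1 - ∑ i, β i) +
            (∑ i : Fin (ℓ - 1), μ ⟨i.1 + 1, by have := i.isLt; omega⟩ * β i) - t) 0 *
          ((1 - ∑ i, β i) ^ (rk ⟨0, by omega⟩ - 1) *
            ∏ i : Fin (ℓ - 1), β i ^ (rk ⟨i.1 + 1, by have := i.isLt; omega⟩ - 1)) /
          (∏ i : Fin ℓ, (Nat.factorial (rk i - 1) : ℝ))) =
      ∫ l in {l : Fin (r - 1) → ℝ | (∀ j, 0 ≤ l j) ∧ (∑ j, l j) ≤ 1},
        max (s ⟨0, by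
              have hpos : 0 < ∑ i, rk i :=
                Finset.sum_pos (fun i _ => hrk i) ⟨⟨0, by omega⟩, Finset.mem_univ _⟩
              omega⟩ * (1 - ∑ j, l j) +
          (∑ j : Fin (r - 1), s ⟨j.1 + 1, by have := j.isLt; omega⟩ * l j) - t) 0 := by
  obtain ⟨n, rfl⟩ : ∃ n, ℓ = n + 1 := ⟨ℓ - 1, by omega⟩
  obtain ⟨k, rfl⟩ : ∃ k : Fin (n + 1) → ℕ, rk = fun i => k i + 1 :=
    ⟨fun i => rk i - 1, funext fun i => (Nat.sub_add_cancel (hrk i)).symm⟩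
  obtain ⟨r, rfl⟩ : ∃ r', r = r' + 1 :=
    ⟨r - 1, by rw [Finset.sum_add_distrib] at hsum; simp at hsum; omega⟩
  have hs' : ∀ p, s ((finSigmaFinEquiv.trans (finCongr hsum)) p) = μ p.1 := by
    intro p
    refine hs p.1 _ ?_ ?_ <;>
      simp only [sum_filter_le_eq_add, sum_filter_lt_eq_sum_castLE, Equiv.trans_apply,
        finCongr_apply, Fin.val_cast, finSigmaFinEquiv_apply]
    · omega
    · have := p.2.isLt
      omega
  have h := setIntegral_simplexIntegrand_blocks _ hs' t
  have hR : ∀ z, simplexIntegrand 0 s t z =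
      max (s 0 * (1 - ∑ j, z j) + (∑ j : Fin r, s j.succ * z j) - t) 0 := by
    intro z; simp [simplexIntegrand]
  simp_rw [hR] at h
  exact h
end
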